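/- arXiv:1307.4569 — 9 statements merged into one kernel-verified Lean document; each statement's English description precedes it below -/
import Mathlib

section
/- Let L be a positive integer. For every subgroup Λ of (ℤ_L)² there exist unique natural numbers a, b, s such that a ∣ L, b ∣ L, 0 ≤ s < b, (a·b / gcd(a·b, L)) ∣ s, and Λ equals the image of the ℤ_L-linear map given by the matrix [[a, 0], [s, b]] (entries coerced into ℤ_L), i.e. Λ = { (a·x, s·x + b·ω) : x, ω ∈ ℤ_L }. -/
theorem Nat.div_gcd_dvd_iff {m : ℕ} (hm : 0 < m) (n s : ℕ) :
    m / m.gcd n ∣ s ↔ m ∣ n * s := by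
  obtain ⟨g, m', n', hg, hco, rfl, rfl⟩ := Nat.exists_coprime' (Nat.gcd_pos_of_pos_left n hm)
  rw [Nat.gcd_mul_right, hco.gcd_eq_one, one_mul, Nat.mul_div_cancel _ hg, mul_right_comm,
    Nat.mul_dvd_mul_iff_right hg, hco.dvd_mul_left]

theorem AddSubgroup.exists_nat_mem_iff_dvd (H : AddSubgroup ℤ) :
    ∃ a : ℕ, ∀ m : ℤ, m ∈ H ↔ (a : ℤ) ∣ m := by
  obtain ⟨a, ha⟩ := Int.subgroup_cyclic H
  refine ⟨a.natAbs, fun m => ?_⟩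
  rw [ha, ← AddSubgroup.zmultiples_eq_closure, Int.mem_zmultiples_iff, Int.natAbs_dvd]

/-- When `a ∣ L`, `b ∣ L` and `a * b ∣ L * s`, the integer points lying over the lattice generated
modulo `L` by `(a, s)` and `(0, b)` are exactly the integer combinations of these two vectors. -/
theorem ZMod.intCast_mem_lattice_iff {L a b s : ℕ} (hL : 0 < L) (ha : a ∣ L) (hb : b ∣ L)
    (hs : a * b ∣ L * s) (m n : ℤ) :
    (∃ x ω : ZMod L, ((m : ZMod L), (n : ZMod L)) = ((a : ZMod L) * x, (s : ZMod L) * x + b * ω)) ↔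
      ∃ x w : ℤ, m = a * x ∧ n = s * x + b * w := by
  constructor
  · rintro ⟨x, ω, h⟩
    obtain ⟨x, rfl⟩ := ZMod.intCast_surjective x
    obtain ⟨w, rfl⟩ := ZMod.intCast_surjective ω
    obtain ⟨h₁, h₂⟩ := Prod.mk.inj h
    have e₁ : ((a * x : ℤ) : ZMod L) = (m : ZMod L) := by push_cast; exact h₁.symm
    have e₂ : ((s * x + b * w : ℤ) : ZMod L) = (n : ZMod L) := by push_cast; exact h₂.symm
    rw [ZMod.intCast_eq_intCast_iff_dvd_sub] at e₁ e₂
    obtain ⟨t, ht⟩ := e₁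
    obtain ⟨u, hu⟩ := e₂
    obtain ⟨c, rfl⟩ := ha
    obtain ⟨d, hd⟩ := hb
    rw [mul_assoc, Nat.mul_dvd_mul_iff_left (Nat.pos_of_mul_pos_right hL)] at hs
    obtain ⟨k, hk⟩ := hs
    zify at hd hk
    push_cast at ht hu
    refine ⟨x + c * t, w + d * u - k * t, by linear_combination ht, ?_⟩
    linear_combination hu + u * hd - t * hk
  · rintro ⟨x, w, rfl, rfl⟩
    exact ⟨x, w, by push_cast; rfl⟩

theorem AddSubgroup.exists_lattice_generators {L : ℕ} (hL : 0 < L)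
    (Λ : AddSubgroup (ZMod L × ZMod L)) :
    ∃ a b s : ℕ, a ∣ L ∧ b ∣ L ∧ s < b ∧ a * b ∣ L * s ∧
      ∀ m n : ℤ, ((m : ZMod L), (n : ZMod L)) ∈ Λ ↔ ∃ x w : ℤ, m = a * x ∧ n = s * x + b * w := by
  let π : ℤ × ℤ →+ ZMod L × ZMod L :=
    (Int.castAddHom (ZMod L)).prodMap (Int.castAddHom (ZMod L))
  let M : AddSubgroup (ℤ × ℤ) := Λ.comap π
  obtain ⟨a, ha⟩ := (M.map (AddMonoidHom.fst ℤ ℤ)).exists_nat_mem_iff_dvd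
  obtain ⟨b, hb⟩ := (M.comap (AddMonoidHom.inr ℤ ℤ)).exists_nat_mem_iff_dvd
  replace hb : ∀ n : ℤ, ((0, n) : ℤ × ℤ) ∈ M ↔ (b : ℤ) ∣ n := hb
  have hmem : ∀ m n : ℤ, (m, n) ∈ M ↔ ((m : ZMod L), (n : ZMod L)) ∈ Λ := fun _ _ => Iff.rfl
  have hLz : ((L : ℤ) : ZMod L) = 0 := by simp
  have haL : a ∣ L := by
    rw [← Int.natCast_dvd_natCast, ← ha]
    exact ⟨(L, 0), (hmem _ _).2 (by rw [hLz, Int.cast_zero]; exact Λ.zero_mem), rfl⟩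
  have hbL : b ∣ L := by
    rw [← Int.natCast_dvd_natCast, ← hb, hmem, hLz, Int.cast_zero]
    exact Λ.zero_mem
  have hb0 : 0 < b := Nat.pos_of_dvd_of_pos hbL hL
  have hbM : ∀ w : ℤ, ((0, b * w) : ℤ × ℤ) ∈ M := fun w => (hb _).2 (dvd_mul_right _ _)
  obtain ⟨⟨a', r⟩, hr, rfl : a' = (a : ℤ)⟩ := (ha a).2 dvd_rfl
  have hbz : (b : ℤ) ≠ 0 := by exact_mod_cast hb0.ne'
  obtain ⟨s, hs⟩ := Int.eq_ofNat_of_zero_le (Int.emod_nonneg r hbz)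
  have hsM : ((a, s) : ℤ × ℤ) ∈ M := by
    convert M.sub_mem hr (hbM (r / b)) using 1
    ext
    · simp
    · simp only [Prod.snd_sub]
      linarith [Int.emod_add_mul_ediv r b]
  have hgen : ∀ x w : ℤ, ((a * x, s * x + b * w) : ℤ × ℤ) ∈ M := fun x w => by
    convert M.add_mem (M.zsmul_mem hsM x) (hbM w) using 1
    ext <;> simp [mul_comm]
  refine ⟨a, b, s, haL, hbL, ?_, ?_, fun m n => ⟨fun h => ?_, ?_⟩⟩
  · have := Int.emod_lt_of_pos r (b := b) (by exact_mod_cast hb0)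
    omega
  · obtain ⟨c, rfl⟩ := haL
    rw [mul_assoc]
    refine Nat.mul_dvd_mul_left a ?_
    rw [← Int.natCast_dvd_natCast, ← hb, hmem]
    have h := (hmem _ _).1 (hgen c 0)
    have h0 : ((a * c : ℤ) : ZMod (a * c)) = 0 := by
      exact_mod_cast ZMod.natCast_self (a * c)
    rw [h0] at h
    simpa [mul_comm] using h
  · obtain ⟨x, rfl⟩ := (ha m).1 ⟨(m, n), h, rfl⟩
    have h' := M.sub_mem ((hmem _ _).2 h) (hgen x 0)
    rw [Prod.mk_sub_mk, sub_self, hb] at h'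
    obtain ⟨w, hw⟩ := h'
    exact ⟨x, w, rfl, by linear_combination hw⟩
  · rintro ⟨x, w, rfl, rfl⟩
    exact hgen x w

theorem Int.hermite_generators_unique {a b s a' b' s' : ℕ} (ha : 0 < a) (ha' : 0 < a')
    (hs : s < b) (hs' : s' < b')
    (h : ∀ m n : ℤ, (∃ x w : ℤ, m = a * x ∧ n = s * x + b * w) ↔
      ∃ x w : ℤ, m = a' * x ∧ n = s' * x + b' * w) :
    a = a' ∧ b = b' ∧ s = s' := by
  have dvd_of {a b s a' b' s' : ℕ} (ha' : 0 < a')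
      (h : ∀ m n : ℤ, (∃ x w : ℤ, m = a * x ∧ n = s * x + b * w) →
        ∃ x w : ℤ, m = a' * x ∧ n = s' * x + b' * w) : a' ∣ a ∧ b' ∣ b := by
    constructor
    · obtain ⟨x, w, hx, -⟩ := h a s ⟨1, 0, by simp, by simp⟩
      exact Int.natCast_dvd_natCast.1 ⟨x, hx⟩
    · obtain ⟨x, w, hx, hw⟩ := h 0 b ⟨0, 1, by simp, by simp⟩
      have hx0 : x = 0 := by simpa [ha'.ne'] using hx.symm
      exact Int.natCast_dvd_natCast.1 ⟨w, by simpa [hx0] using hw⟩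
  have h₁ := dvd_of ha' fun m n => (h m n).1
  have h₂ := dvd_of ha fun m n => (h m n).2
  obtain rfl := Nat.dvd_antisymm h₂.1 h₁.1
  obtain rfl := Nat.dvd_antisymm h₂.2 h₁.2
  refine ⟨rfl, rfl, ?_⟩
  obtain ⟨x, w, hx, hw⟩ := (h a s).1 ⟨1, 0, by simp, by simp⟩
  have hx1 : x = 1 := by
    have : (a : ℤ) ≠ 0 := by exact_mod_cast ha.ne'
    exact mul_left_cancel₀ this (by rw [← hx, mul_one])
  subst hx1
  have hmod : (s : ℤ) % b = s' % b := by rw [hw, mul_one, Int.add_mul_emod_self_left]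
  have hmod' : s % b = s' % b := by exact_mod_cast hmod
  rwa [Nat.mod_eq_of_lt hs, Nat.mod_eq_of_lt hs'] at hmod'

/-- Lattice normal form. For every subgroup `Λ` of `(ℤ_L)²` there exist
unique `a, b, s : ℕ` with `a ∣ L`, `b ∣ L`, `s < b`, `(a*b / gcd(a*b, L)) ∣ s` such that
`Λ` is the image of the linear map given by the matrix `[[a, 0], [s, b]]`. -/
theorem lattice_normal_form (L : ℕ) [NeZero L] (Λ : AddSubgroup (ZMod L × ZMod L)) :
    ∃! abs : ℕ × ℕ × ℕ,
      abs.1 ∣ L ∧ abs.2.1 ∣ L ∧ abs.2.2 < abs.2.1 ∧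
      (abs.1 * abs.2.1 / Nat.gcd (abs.1 * abs.2.1) L) ∣ abs.2.2 ∧
      (Λ : Set (ZMod L × ZMod L)) =
        {p : ZMod L × ZMod L | ∃ x ω : ZMod L,
          p = ((abs.1 : ZMod L) * x, (abs.2.2 : ZMod L) * x + (abs.2.1 : ZMod L) * ω)} := by

  have hL : 0 < L := NeZero.pos L
  have hcond {a b s : ℕ} (ha : a ∣ L) (hb : b ∣ L) :
      a * b / Nat.gcd (a * b) L ∣ s ↔ a * b ∣ L * s :=
    Nat.div_gcd_dvd_iff (Nat.mul_pos (Nat.pos_of_dvd_of_pos ha hL) (Nat.pos_of_dvd_of_pos hb hL)) _ _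
  obtain ⟨a, b, s, ha, hb, hs, hd, hΛ⟩ := Λ.exists_lattice_generators hL
  refine ⟨(a, b, s), ⟨ha, hb, hs, (hcond ha hb).2 hd, ?_⟩, ?_⟩
  · ext ⟨p, q⟩
    obtain ⟨m, rfl⟩ := ZMod.intCast_surjective p
    obtain ⟨n, rfl⟩ := ZMod.intCast_surjective q
    exact (hΛ m n).trans (ZMod.intCast_mem_lattice_iff hL ha hb hd m n).symm
  · rintro ⟨a', b', s'⟩ ⟨ha', hb', hs', hd', h'⟩
    dsimp only at ha' hb' hs' hd' h'
    rw [hcond ha' hb'] at hd'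
    have key (m n : ℤ) := (ZMod.intCast_mem_lattice_iff hL ha' hb' hd' m n).symm.trans
      ((Set.ext_iff.1 h' (m, n)).symm.trans (hΛ m n))
    obtain ⟨rfl, rfl, rfl⟩ := Int.hermite_generators_unique (Nat.pos_of_dvd_of_pos ha' hL)
      (Nat.pos_of_dvd_of_pos ha hL) hs' hs key
    rfl
end

section
/- Let L be a positive integer and let a, b, s be natural numbers with b > 0. Set g = gcd(b, s), b̃ = g, ã = a·b / g, and let k₁, k₂ be integers with k₁·s + k₂·b = g (Bézout coefficients), and set s̃ = k₁·a. Then the image of the linear map on (ℤ_L)² given by the matrix [[a, 0], [s, b]] equals the image of the linear map given by the matrix [[ã, s̃], [0, b̃]] (all entries coerced into ℤ_L, with the integer s̃ cast via the canonical ring homomorphism ℤ → ℤ_L). -/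
/-- The lower triangular lattice generated by `[[a, 0], [s, b]]` equals
the upper triangular lattice generated by `[[ã, s̃], [0, b̃]]` with `b̃ = gcd(b,s)`,
`ã = a*b/gcd(b,s)` and `s̃ = k₁*a` for Bézout coefficients `k₁*s + k₂*b = gcd(b,s)`. -/
theorem lattice_upper_triangular_form (L : ℕ) (hL : 0 < L) (a b s : ℕ) (hb : 0 < b)
    (k₁ k₂ : ℤ) (hbez : k₁ * (s : ℤ) + k₂ * (b : ℤ) = (Nat.gcd b s : ℤ)) :
    {p : ZMod L × ZMod L | ∃ x ω : ZMod L,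
        p = ((a : ZMod L) * x, (s : ZMod L) * x + (b : ZMod L) * ω)} =
    {p : ZMod L × ZMod L | ∃ x ω : ZMod L,
        p = (((a * b / Nat.gcd b s : ℕ) : ZMod L) * x + ((k₁ * (a : ℤ) : ℤ) : ZMod L) * ω,
             ((Nat.gcd b s : ℕ) : ZMod L) * ω)} := by
  obtain ⟨b', hb'⟩ := Nat.gcd_dvd_left b s
  obtain ⟨s', hs'⟩ := Nat.gcd_dvd_right b s
  have hg : 0 < Nat.gcd b s := Nat.gcd_pos_of_pos_left s hb
  generalize Nat.gcd b s = g at *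
  subst hb' hs'
  have hdiv : a * (g * b') / g = a * b' := by
    rw [mul_left_comm, Nat.mul_div_cancel_left _ hg]
  have hunit : k₁ * (s' : ℤ) + k₂ * (b' : ℤ) = 1 := by
    have hg' : (g : ℤ) ≠ 0 := by exact_mod_cast hg.ne'
    apply mul_left_cancel₀ hg'
    push_cast at hbez
    linear_combination hbez
  have hunitL : (k₁ : ZMod L) * s' + k₂ * b' = 1 := by
    exact_mod_cast congrArg (Int.cast : ℤ → ZMod L) hunit
  rw [hdiv]
  ext ⟨p, q⟩
  simp only [Set.mem_ofPred_eq, Prod.mk.injEq]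
  push_cast
  constructor
  · rintro ⟨x, ω, rfl, rfl⟩
    refine ⟨k₂ * x - k₁ * ω, s' * x + b' * ω, ?_, by ring⟩
    linear_combination -(a : ZMod L) * x * hunitL
  · rintro ⟨x, ω, rfl, rfl⟩
    refine ⟨b' * x + k₁ * ω, -s' * x + k₂ * ω, by ring, ?_⟩
    linear_combination -(g : ZMod L) * ω * hunitL
end

section
/- Let L be a positive integer and let M = [[a, b], [c, d]] be a 2×2 matrix over ℤ_L with det M = 1. Then there exists m ∈ ℤ_L such that a₀ := a + m·b is a unit of ℤ_L, and for any such m, setting c₀ := c + m·d, one has the matrix factorization M = S_{c₀·a₀⁻¹} · D_{a₀} · F⁻¹ · S_{−a₀⁻¹·b} · F · S_{−m}, where F = [[0, −1], [1, 0]], S_c = [[1, 0], [c, 1]] for c ∈ ℤ_L, and D_u = [[u, 0], [0, u⁻¹]] for a unit u of ℤ_L. -/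
/-- If `a` and `b` generate the unit ideal of `ZMod L`, then some `a + m * b` is a unit:
take for `m` the product of the primes dividing `L` but not `a`. -/
theorem ZMod.exists_isUnit_add_mul {L : ℕ} [NeZero L] {a b : ZMod L} (hab : IsCoprime a b) :
    ∃ m : ZMod L, IsUnit (a + m * b) := by
  obtain ⟨r, s, hrs⟩ := hab
  let m : ℕ := ∏ p ∈ L.primeFactors with ¬ p ∣ a.val, p
  have hcop : (a.val + m * b.val).Coprime L := by
    refine Nat.coprime_of_dvd fun p hp hpab hpL => ?_
    have hpm : p ∣ m ↔ ¬ p ∣ a.val := by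
      refine ⟨fun h hpa => ?_, fun h => Finset.dvd_prod_of_mem _ ?_⟩
      · obtain ⟨q, hq, hpq⟩ := (hp.prime.dvd_finsetProd_iff _).1 h
        rw [Finset.mem_filter] at hq
        rw [(Nat.prime_dvd_prime_iff_eq hp (Nat.prime_of_mem_primeFactors hq.1)).1 hpq] at hpa
        exact hq.2 hpa
      · simp [hp, hpL, NeZero.ne L, h]
    by_cases hpa : p ∣ a.val
    · have hpb : p ∣ b.val :=
        (hp.dvd_mul.1 ((Nat.dvd_add_right hpa).1 hpab)).resolve_left (by simpa [hpm] using hpa)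
      have hone := congrArg (ZMod.castHom hpL (ZMod p)) hrs
      have hzero (x : ZMod L) (hx : p ∣ x.val) : ZMod.castHom hpL (ZMod p) x = 0 := by
        rw [← ZMod.natCast_zmod_val x, map_natCast, ZMod.natCast_eq_zero_iff]
        exact hx
      have : Fact p.Prime := ⟨hp⟩
      rw [map_add, map_mul, map_mul, hzero a hpa, hzero b hpb, mul_zero, mul_zero, add_zero,
        map_one] at hone
      exact zero_ne_one hone
    · exact hpa ((Nat.dvd_add_left ((hpm.2 hpa).mul_right _)).1 hpab)
  refine ⟨m, ?_⟩
  simpa using (ZMod.isUnit_iff_coprime _ L).2 hcop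

/-- Weil-type decomposition of a determinant-1 matrix over `ℤ_L` into
elementary symplectic matrices: there is `m` with `a₀ = a + m*b` a unit, and for any
such `m`, with `c₀ = c + m*d`, one has
`M = S_{c₀·a₀⁻¹} · D_{a₀} · F⁻¹ · S_{−a₀⁻¹·b} · F · S_{−m}`. -/
theorem weil_decomposition (L : ℕ) [NeZero L] (M : Matrix (Fin 2) (Fin 2) (ZMod L))
    (hdet : M.det = 1) :
    (∃ m : ZMod L, IsUnit (M 0 0 + m * M 0 1)) ∧
    (∀ m : ZMod L, ∀ h : IsUnit (M 0 0 + m * M 0 1),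
      M = !![(1 : ZMod L), 0; (M 1 0 + m * M 1 1) * (↑h.unit⁻¹ : ZMod L), 1] *
          !![M 0 0 + m * M 0 1, 0; 0, (↑h.unit⁻¹ : ZMod L)] *
          (!![(0 : ZMod L), -1; 1, 0])⁻¹ *
          !![(1 : ZMod L), 0; -((↑h.unit⁻¹ : ZMod L) * M 0 1), 1] *
          !![(0 : ZMod L), -1; 1, 0] *
          !![(1 : ZMod L), 0; -m, 1]) := by
  rw [Matrix.det_fin_two] at hdet
  refine ⟨ZMod.exists_isUnit_add_mul ⟨M 1 1, -M 1 0, by linear_combination hdet⟩,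
    fun m h => ?_⟩
  have hinv : (!![(0 : ZMod L), -1; 1, 0])⁻¹ = !![0, 1; -1, 0] :=
    Matrix.inv_eq_right_inv (by simp [Matrix.one_fin_two])
  have hu : (M 0 0 + m * M 0 1) * (↑h.unit⁻¹ : ZMod L) = 1 := h.mul_val_inv
  generalize (↑h.unit⁻¹ : ZMod L) = u at hu ⊢
  rw [hinv]
  ext i j
  fin_cases i <;> fin_cases j <;> simp [Matrix.mul_apply, Fin.sum_univ_two]
  · linear_combination m * M 0 1 * hu
  · linear_combination -M 0 1 * hu
  · linear_combination (-(M 1 0 + m * M 1 1) + m * ((M 1 0 + m * M 1 1) * M 0 1 * u + M 1 1)) * hu -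
      m * u * hdet
  · linear_combination -((M 1 0 + m * M 1 1) * M 0 1 * u + M 1 1) * hu + u * hdet
end

section
/- Let L be a positive integer. For an integer c, define the discrete chirp p_c : ℤ_L → ℂ by p_c(l) = exp(πi·c·val(l)²·(L+1)/L), and the chirp multiplication operator U_c f = p_c · f (pointwise product). Then for all integers x and ω and all f : ℤ_L → ℂ, U_c(M_ω T_x f) = exp(−πi·c·x²·(L+1)/L) · M_{ω + c·x} T_x (U_c f); that is, U_c intertwines the time-frequency shift π(x, ω) = M_ω T_x with π(x, ω + c·x) up to a unimodular phase factor. -/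
open Complex

/-- Translation operator `(T_x f)(l) = f(l - x)` for an integer `x`. -/
noncomputable def Tr (L : ℕ) (x : ℤ) (f : ZMod L → ℂ) : ZMod L → ℂ :=
  fun l => f (l - (x : ZMod L))

/-- Modulation operator `(M_ω f)(l) = exp(2πi·val(l)·ω/L)·f(l)` for an integer `ω`. -/
noncomputable def Md (L : ℕ) (ω : ℤ) (f : ZMod L → ℂ) : ZMod L → ℂ :=
  fun l => Complex.exp (2 * Real.pi * Complex.I * (l.val : ℂ) * (ω : ℂ) / (L : ℂ)) * f l

/-- The discrete chirp `p_c(l) = exp(πi·c·val(l)²·(L+1)/L)`. -/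
noncomputable def chirp (L : ℕ) (c : ℤ) : ZMod L → ℂ :=
  fun l => Complex.exp (Real.pi * Complex.I * (c : ℂ) * (l.val : ℂ) ^ 2 *
    ((L : ℂ) + 1) / (L : ℂ))

/-- The chirp multiplication operator `U_c f = p_c · f`. -/
noncomputable def chirpOp (L : ℕ) (c : ℤ) (f : ZMod L → ℂ) : ZMod L → ℂ :=
  fun l => chirp L c l * f l

/-- The chirp multiplication `U_c` intertwines `π(x, ω) = M_ω T_x` with
`π(x, ω + c·x)` up to the phase factor `exp(−πi·c·x²·(L+1)/L)`. -/
theorem chirp_intertwines_tf_shift (L : ℕ) [NeZero L] (c x ω : ℤ) (f : ZMod L → ℂ) :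
    chirpOp L c (Md L ω (Tr L x f)) =
      fun l => Complex.exp (-(Real.pi * Complex.I * (c : ℂ) * (x : ℂ) ^ 2 *
          ((L : ℂ) + 1)) / (L : ℂ)) *
        Md L (ω + c * x) (Tr L x (chirpOp L c f)) l := by
  have hL : (L : ℂ) ≠ 0 := Nat.cast_ne_zero.mpr (NeZero.ne L)
  funext l
  obtain ⟨k, hk⟩ : (L : ℤ) ∣ ((l - (x : ZMod L)).val : ℤ) - ((l.val : ℤ) - x) := by
    rw [← ZMod.intCast_zmod_eq_zero_iff_dvd]
    simp
  obtain ⟨m, hm⟩ : Even ((L : ℤ) * (L + 1)) := Int.even_mul_succ_self L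
  have hb : ((l - (x : ZMod L)).val : ℂ) = (l.val : ℂ) - x + L * k := by
    have h : ((l - (x : ZMod L)).val : ℤ) = (l.val : ℤ) - x + L * k := by linarith
    exact_mod_cast congrArg (Int.cast : ℤ → ℂ) h
  have hm' : (L : ℂ) * (L + 1) = m + m := by exact_mod_cast congrArg (Int.cast : ℤ → ℂ) hm
  simp only [chirpOp, Md, Tr, chirp]
  simp only [← mul_assoc, ← Complex.exp_add]
  congr 1
  rw [Complex.exp_eq_exp_iff_exists_int]
  refine ⟨-(c * (-(l.val * x) + (L + 1) * (l.val - x) * k + k ^ 2 * m)), ?_⟩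
  rw [hb]
  push_cast
  field_simp
  linear_combination (-(c : ℂ) * k ^ 2 * L) * hm'
end

section
/- Let L be a positive integer and let a, b, s be natural numbers with a ∣ L, b ∣ L, 0 < b, 0 ≤ s < b, and (a·b / gcd(a·b, L)) ∣ s. Set λ₂ = b / gcd(b, s) (with the convention gcd(b, 0) = b). Let Λ be the image of the linear map on (ℤ_L)² given by the matrix [[a, 0], [s, b]], and let Λ̃ be the image of the linear map given by [[λ₂·a, 0], [0, b]]. Then Λ = ⋃_{m = 0}^{λ₂ − 1} ( (a·m, s·m mod b) + Λ̃ ), where (a·m, s·m mod b) is coerced into (ℤ_L)² and the sum is the coset of Λ̃ by that element. -/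
/-- Multiwindow decomposition of a nonseparable lattice. The lattice
generated by `[[a, 0], [s, b]]` is the union over `m < λ₂` of the cosets
`(a·m, s·m mod b) + Λ̃` of the separable lattice `Λ̃` generated by `[[λ₂·a, 0], [0, b]]`,
where `λ₂ = b / gcd(b, s)`. -/
theorem multiwindow_lattice_decomposition (L : ℕ) (hL : 0 < L) (a b s : ℕ)
    (ha : a ∣ L) (hb : b ∣ L) (hb0 : 0 < b) (hs : s < b)
    (hdvd : (a * b / Nat.gcd (a * b) L) ∣ s) :
    {p : ZMod L × ZMod L | ∃ x ω : ZMod L,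
        p = ((a : ZMod L) * x, (s : ZMod L) * x + (b : ZMod L) * ω)} =
    ⋃ m ∈ Finset.range (b / Nat.gcd b s),
      (fun p : ZMod L × ZMod L =>
          (((a * m : ℕ) : ZMod L), ((s * m % b : ℕ) : ZMod L)) + p) ''
        {p : ZMod L × ZMod L | ∃ x ω : ZMod L,
          p = (((b / Nat.gcd b s * a : ℕ) : ZMod L) * x, (b : ZMod L) * ω)} := by
  have : NeZero L := ⟨hL.ne'⟩
  set l := b / Nat.gcd b s with hl
  have hl0 : 0 < l := Nat.div_pos (Nat.gcd_le_left s hb0) (Nat.gcd_pos_of_pos_left s hb0)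
  have hsl : s * l = b * (s / Nat.gcd b s) := by
    rw [hl, ← Nat.mul_div_assoc _ (Nat.gcd_dvd_left b s),
      ← Nat.mul_div_assoc _ (Nat.gcd_dvd_right b s), mul_comm]
  set t := s / Nat.gcd b s
  have hsl' : (s : ZMod L) * l = b * t := by exact_mod_cast congrArg (Nat.cast (R := ZMod L)) hsl
  have hmod (m : ℕ) : ((s * m % b : ℕ) : ZMod L) + b * (s * m / b : ℕ) = s * m := by
    exact_mod_cast congrArg (Nat.cast (R := ZMod L)) (Nat.mod_add_div (s * m) b)
  ext p
  simp only [Set.mem_ofPred_eq, Set.mem_iUnion, Set.mem_image, Finset.mem_range, exists_prop]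
  constructor
  · rintro ⟨x, ω, rfl⟩
    set m := x.val % l
    set k := x.val / l
    have hx : x = m + l * k := by
      rw [← ZMod.natCast_zmod_val x]
      exact_mod_cast congrArg (Nat.cast (R := ZMod L)) (Nat.mod_add_div x.val l).symm
    refine ⟨m, Nat.mod_lt _ hl0, _, ⟨k, t * k + (s * m / b : ℕ) + ω, rfl⟩, ?_⟩
    refine Prod.ext ?_ ?_
    · simp only [Prod.mk_add_mk, hx]
      push_cast
      ring
    · simp only [Prod.mk_add_mk, hx]
      linear_combination hmod m - k * hsl'
  · rintro ⟨m, -, _, ⟨x, ω, rfl⟩, rfl⟩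
    refine ⟨m + l * x, ω - t * x - (s * m / b : ℕ), Prod.ext ?_ ?_⟩
    · simp only [Prod.mk_add_mk]
      push_cast
      ring
    · simp only [Prod.mk_add_mk]
      linear_combination hmod m - x * hsl'
end

section
/- Let L be a positive integer and let a, b, s be natural numbers with a ∣ L, b ∣ L, 0 < b, 0 ≤ s < b, and (a·b / gcd(a·b, L)) ∣ s. Set λ₂ = b / gcd(b, s) (with gcd(b, 0) = b) and ã = λ₂·a, and assume ã ∣ L. Let g : ℤ_L → ℂ and for 0 ≤ m < λ₂ set g_m = M_{m·s mod b} T_{m·a} g. Then for every f : ℤ_L → ℂ, Σ_{n = 0}^{L/a − 1} Σ_{k = 0}^{L/b − 1} ⟨f, M_{n·s + k·b} T_{n·a} g⟩ · M_{n·s + k·b} T_{n·a} g = Σ_{m = 0}^{λ₂ − 1} Σ_{ñ = 0}^{L/ã − 1} Σ_{k = 0}^{L/b − 1} ⟨f, M_{k·b} T_{ñ·ã} g_m⟩ · M_{k·b} T_{ñ·ã} g_m, i.e. the Gabor frame operator of the nonseparable lattice equals the sum of the λ₂ multiwindow frame operators on the separable lattice. -/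
open Complex

/-- Inner product `⟨f, g⟩ = Σ_l f(l)·conj(g(l))`. -/
noncomputable def ip (L : ℕ) [NeZero L] (f g : ZMod L → ℂ) : ℂ :=
  ∑ l : ZMod L, f l * (starRingEnd ℂ) (g l)

/-- Modulation in terms of the standard additive character. -/
theorem Md_apply_eq_stdAddChar (L : ℕ) [NeZero L] (ω : ℤ) (f : ZMod L → ℂ) (l : ZMod L) :
    Md L ω f l = ZMod.stdAddChar (l * (ω : ZMod L)) * f l := by
  have h : l * (ω : ZMod L) = (((l.val : ℤ) * ω : ℤ) : ZMod L) := by simp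
  rw [h, ZMod.stdAddChar_coe, Md]
  congr 2
  push_cast
  ring

/-- Modulation depends only on the frequency modulo `L`. -/
theorem Md_congr (L : ℕ) [NeZero L] {ω ω' : ℤ} (h : (ω : ZMod L) = (ω' : ZMod L))
    (f : ZMod L → ℂ) : Md L ω f = Md L ω' f := by
  ext l
  rw [Md_apply_eq_stdAddChar, Md_apply_eq_stdAddChar, h]

/-- Commuting a translation past a modulation produces a phase factor. -/
theorem Md_Tr_Md_Tr (L : ℕ) [NeZero L] (ω x ω' x' : ℤ) (g : ZMod L → ℂ) :
    Md L ω (Tr L x (Md L ω' (Tr L x' g))) =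
      ZMod.stdAddChar (-((x : ZMod L) * (ω' : ZMod L))) • Md L (ω' + ω) (Tr L (x' + x) g) := by
  ext l
  simp only [Md_apply_eq_stdAddChar, Tr, Pi.smul_apply, smul_eq_mul]
  rw [← mul_assoc, ← mul_assoc, ← AddChar.map_add_eq_mul, ← AddChar.map_add_eq_mul]
  push_cast
  congr 2 <;> ring

/-- A rank-one term is unchanged when its window is multiplied by a phase. -/
theorem ip_smul_smul_of_norm_eq_one (L : ℕ) [NeZero L] (f h : ZMod L → ℂ) {c : ℂ}
    (hc : ‖c‖ = 1) : ip L f (c • h) • (c • h) = ip L f h • h := by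
  have h1 : ip L f (c • h) = (starRingEnd ℂ) c * ip L f h := by
    simp only [ip, Pi.smul_apply, smul_eq_mul, map_mul, Finset.mul_sum]
    exact Finset.sum_congr rfl fun _ _ => by ring
  rw [h1, smul_smul, mul_right_comm, Complex.conj_mul', hc]
  simp

/-- The sum of a periodic function over a period does not depend on the starting point. -/
theorem sum_range_add_of_periodic {E : Type*} [AddCommGroup E] {G : ℕ → E} {N : ℕ}
    (hG : Function.Periodic G N) (q : ℕ) :
    ∑ k ∈ Finset.range N, G (q + k) = ∑ k ∈ Finset.range N, G k := by
  induction q with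
  | zero => simp
  | succ q ih =>
    rw [← ih]
    have h := Finset.sum_range_succ (fun k => G (q + k)) N
    rw [Finset.sum_range_succ', hG q, add_zero] at h
    rw [← add_right_cancel h]
    exact Finset.sum_congr rfl fun k _ => by congr 1; ring

/-- Splitting a sum over a range according to the residue modulo `d`. -/
theorem sum_range_mul_eq_sum_residues {E : Type*} [AddCommMonoid E] (F : ℕ → E) (d N : ℕ) :
    ∑ n ∈ Finset.range (d * N), F n =
      ∑ m ∈ Finset.range d, ∑ n ∈ Finset.range N, F (d * n + m) := by
  rw [Finset.sum_comm]
  induction N with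
  | zero => simp
  | succ N ih => rw [Nat.mul_succ, Finset.sum_range_add, ih, Finset.sum_range_succ]

/-- The Gabor frame operator of the nonseparable lattice generated by
`[[a, 0], [s, b]]` equals the sum of the `λ₂` multiwindow frame operators on the
separable lattice generated by `[[ã, 0], [0, b]]`, with `λ₂ = b/gcd(b,s)`, `ã = λ₂·a`
and windows `g_m = M_{m·s mod b} T_{m·a} g`. -/
theorem multiwindow_frame_operator (L : ℕ) [NeZero L] (a b s : ℕ)
    (ha : a ∣ L) (hb : b ∣ L) (hb0 : 0 < b) (hs : s < b)
    (hdvd : (a * b / Nat.gcd (a * b) L) ∣ s)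
    (hatilde : (b / Nat.gcd b s) * a ∣ L) (f g : ZMod L → ℂ) :
    (∑ n ∈ Finset.range (L / a), ∑ k ∈ Finset.range (L / b),
      ip L f (Md L ((n * s + k * b : ℕ) : ℤ) (Tr L ((n * a : ℕ) : ℤ) g)) •
        Md L ((n * s + k * b : ℕ) : ℤ) (Tr L ((n * a : ℕ) : ℤ) g)) =
    (∑ m ∈ Finset.range (b / Nat.gcd b s),
      ∑ n ∈ Finset.range (L / (b / Nat.gcd b s * a)),
        ∑ k ∈ Finset.range (L / b),
          ip L f (Md L ((k * b : ℕ) : ℤ) (Tr L ((n * (b / Nat.gcd b s * a) : ℕ) : ℤ)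
              (Md L ((m * s % b : ℕ) : ℤ) (Tr L ((m * a : ℕ) : ℤ) g)))) •
            Md L ((k * b : ℕ) : ℤ) (Tr L ((n * (b / Nat.gcd b s * a) : ℕ) : ℤ)
              (Md L ((m * s % b : ℕ) : ℤ) (Tr L ((m * a : ℕ) : ℤ) g)))) := by
  have hL : 0 < L := Nat.pos_of_ne_zero (NeZero.ne L)
  set d := b / Nat.gcd b s with hd
  have hds : b ∣ d * s := by
    obtain ⟨t, ht⟩ := Nat.gcd_dvd_right b s
    refine ⟨t, ?_⟩
    calc d * s = d * Nat.gcd b s * t := by rw [mul_assoc, ← ht]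
      _ = b * t := by rw [hd, Nat.div_mul_cancel (Nat.gcd_dvd_left b s)]
  have hLa : L / a = d * (L / (d * a)) := by
    obtain ⟨N, hN⟩ := hatilde
    have hda : 0 < d * a := Nat.pos_of_ne_zero fun h => by simp [h] at hN; omega
    have ha0 : 0 < a := Nat.pos_of_mul_pos_left hda
    rw [hN, Nat.mul_div_cancel_left _ hda]
    exact Nat.div_eq_of_eq_mul_left ha0 (by ring)
  rw [hLa, sum_range_mul_eq_sum_residues]
  refine Finset.sum_congr rfl fun m _ => Finset.sum_congr rfl fun n _ => ?_
  set h : ZMod L → ℂ := Tr L (((d * n + m) * a : ℕ) : ℤ) g with hh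
  set G : ℕ → ZMod L → ℂ := fun k =>
    ip L f (Md L ((m * s % b + k * b : ℕ) : ℤ) h) • Md L ((m * s % b + k * b : ℕ) : ℤ) h with hG
  have hper : Function.Periodic G (L / b) := fun k => by
    have e : Md L ((m * s % b + (k + L / b) * b : ℕ) : ℤ) h =
        Md L ((m * s % b + k * b : ℕ) : ℤ) h := by
      apply Md_congr
      rw [add_mul k, Nat.div_mul_cancel hb]
      simp
    simp only [hG, e]
  obtain ⟨t, ht⟩ := hds
  have hq : (d * n + m) * s = m * s % b + (n * t + m * s / b) * b := by
    have h1 := Nat.mod_add_div (m * s) b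
    calc (d * n + m) * s = d * s * n + m * s := by ring
      _ = b * t * n + (m * s % b + b * (m * s / b)) := by rw [ht, h1]
      _ = _ := by ring
  calc _ = ∑ k ∈ Finset.range (L / b), G (n * t + m * s / b + k) := by
        refine Finset.sum_congr rfl fun k _ => ?_
        simp only [hG]
        rw [hq, add_assoc, ← add_mul]
    _ = ∑ k ∈ Finset.range (L / b), G k := sum_range_add_of_periodic hper _
    _ = _ := by
        refine Finset.sum_congr rfl fun k _ => ?_
        rw [Md_Tr_Md_Tr, ip_smul_smul_of_norm_eq_one _ _ _ (AddChar.norm_apply _ _)]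
        have e : ((m * a : ℕ) : ℤ) + ((n * (d * a) : ℕ) : ℤ) = (((d * n + m) * a : ℕ) : ℤ) := by
          push_cast
          ring
        rw [e, ← Nat.cast_add]
end

section
/- Let L be a positive integer and let a, b, s be natural numbers with a ∣ L, b ∣ L, 0 < b, 0 ≤ s < b. Set λ₂ = b / gcd(b, s) (with gcd(b, 0) = b) and ã = λ₂·a. Let f, g : ℤ_L → ℂ. Then for all natural numbers n and k, writing ñ = ⌊n / λ₂⌋ and m = n mod λ₂ and g_m = M_{m·s mod b} T_{m·a} g, one has ⟨f, M_{k·b + (m·s mod b)} T_{n·a} g⟩ = exp(−2πi·ñ·ã·(m·s mod b)/L) · ⟨f, M_{k·b} T_{ñ·ã} g_m⟩. -/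
open Complex

theorem Tr_Tr (L : ℕ) (x y : ℤ) (f : ZMod L → ℂ) :
    Tr L x (Tr L y f) = Tr L (x + y) f := by
  funext l
  simp only [Tr, Int.cast_add]
  congr 1
  ring

theorem Md_Md (L : ℕ) [NeZero L] (ω η : ℤ) (f : ZMod L → ℂ) :
    Md L ω (Md L η f) = Md L (ω + η) f := by
  funext l
  simp only [Md_apply_eq_stdAddChar, Int.cast_add, mul_add, AddChar.map_add_eq_mul, mul_assoc]

/-- Translation and modulation commute up to a phase factor. -/
theorem Tr_Md (L : ℕ) [NeZero L] (x ω : ℤ) (f : ZMod L → ℂ) :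
    Tr L x (Md L ω f) =
      (ZMod.stdAddChar (-((x * ω : ℤ) : ZMod L)) : ℂ) • Md L ω (Tr L x f) := by
  funext l
  simp only [Tr, Pi.smul_apply, smul_eq_mul, Md_apply_eq_stdAddChar]
  rw [← mul_assoc, ← AddChar.map_add_eq_mul]
  congr 2
  push_cast
  ring

theorem Md_smul (L : ℕ) (ω : ℤ) (c : ℂ) (f : ZMod L → ℂ) :
    Md L ω (c • f) = c • Md L ω f := by
  funext l
  simp only [Md, Pi.smul_apply, smul_eq_mul]
  ring

theorem ip_smul_right (L : ℕ) [NeZero L] (c : ℂ) (f g : ZMod L → ℂ) :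
    ip L f (c • g) = (starRingEnd ℂ) c * ip L f g := by
  simp only [ip, Pi.smul_apply, smul_eq_mul, map_mul, Finset.mul_sum]
  exact Finset.sum_congr rfl fun l _ => by ring

/-- Gabor coefficients on the nonseparable lattice are, up to explicit
phase factors, Gabor coefficients of the windows `g_m = M_{m·s mod b} T_{m·a} g` on
the separable lattice: with `λ₂ = b/gcd(b,s)`, `ã = λ₂·a`, `ñ = ⌊n/λ₂⌋`, `m = n mod λ₂`,
`⟨f, M_{k·b+(m·s mod b)} T_{n·a} g⟩ = exp(−2πi·ñ·ã·(m·s mod b)/L)·⟨f, M_{k·b} T_{ñ·ã} g_m⟩`. -/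
theorem multiwindow_coefficients (L : ℕ) [NeZero L] (a b s : ℕ)
    (ha : a ∣ L) (hb : b ∣ L) (hb0 : 0 < b) (hs : s < b)
    (f g : ZMod L → ℂ) (n k : ℕ) :
    ip L f (Md L ((k * b + (n % (b / Nat.gcd b s) * s % b) : ℕ) : ℤ)
        (Tr L ((n * a : ℕ) : ℤ) g)) =
      Complex.exp (-(2 * Real.pi * Complex.I *
          ((n / (b / Nat.gcd b s) : ℕ) : ℂ) * ((b / Nat.gcd b s * a : ℕ) : ℂ) *
          ((n % (b / Nat.gcd b s) * s % b : ℕ) : ℂ)) / (L : ℂ)) *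
        ip L f (Md L ((k * b : ℕ) : ℤ)
          (Tr L ((n / (b / Nat.gcd b s) * (b / Nat.gcd b s * a) : ℕ) : ℤ)
            (Md L ((n % (b / Nat.gcd b s) * s % b : ℕ) : ℤ)
              (Tr L ((n % (b / Nat.gcd b s) * a : ℕ) : ℤ) g)))) := by
  generalize n % (b / Nat.gcd b s) * s % b = w
  have hn : n * a = n / (b / Nat.gcd b s) * (b / Nat.gcd b s * a) +
      n % (b / Nat.gcd b s) * a := by
    rw [← mul_assoc, ← add_mul, Nat.div_add_mod']
  rw [hn, mul_assoc (2 * (Real.pi : ℂ) * Complex.I), ← Nat.cast_mul]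
  generalize n / (b / Nat.gcd b s) * (b / Nat.gcd b s * a) = x
  rw [Tr_Md, Md_smul, ip_smul_right, Md_Md, Tr_Tr, ← AddChar.map_neg_eq_conj, neg_neg,
    ← mul_assoc, ← Nat.cast_add, ← Nat.cast_add]
  have hphase : Complex.exp (-(2 * Real.pi * Complex.I * (x : ℂ) * (w : ℂ)) / (L : ℂ)) =
      ZMod.stdAddChar (-(((x : ℤ) * (w : ℤ) : ℤ) : ZMod L)) := by
    rw [← Int.cast_neg, ZMod.stdAddChar_coe]
    push_cast
    congr 1
    ring
  rw [hphase, ← AddChar.map_add_eq_mul, neg_add_cancel, AddChar.map_zero_eq_one, one_mul]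
end

section
/- Let L be a positive integer and let a, b, s be natural numbers with a ∣ L, b ∣ L, 0 < b, 0 ≤ s < b, and (a·b / gcd(a·b, L)) ∣ s, and let A = [[a, 0], [s, b]] with entries coerced into ℤ_L. Then there exist integers s₀ and s₁, a diagonal 2×2 matrix D over ℤ_L, and a 2×2 matrix V over ℤ_L with det V = 1, such that A = U_{s₀,s₁} · D · V, where U_{s₀,s₁} = [[1, −s₀], [−s₁, s₀·s₁ + 1]] (entries cast via the canonical ring homomorphism ℤ → ℤ_L). In particular, every lattice in (ℤ_L)² is the image of a separable lattice D(ℤ_L)² under the composition of at most one time-side shear and one frequency-side shear. -/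
/-- In an arithmetic progression with coprime first term and step, some term is coprime to any given
nonzero natural number. -/
theorem exists_isCoprime_add_mul {x y b : ℕ} (hy : y ≠ 0) (hb : b ≠ 0) (h : x.Coprime y) :
    ∃ n : ℤ, IsCoprime ((x : ℤ) + n * y) (b : ℤ) := by
  have : NeZero (y * b) := ⟨mul_ne_zero hy hb⟩
  obtain ⟨u, hu⟩ := ZMod.unitsMap_surjective (dvd_mul_right y b) (ZMod.unitOfCoprime x h)
  have hval : (((u : ZMod (y * b)).val : ℕ) : ZMod y) = (x : ZMod y) := by
    have := congrArg (fun v : (ZMod y)ˣ => (v : ZMod y)) hu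
    simpa [ZMod.unitsMap_def, ZMod.natCast_val] using this
  have hmod : (y : ℤ) ∣ ((u : ZMod (y * b)).val : ℤ) - x := by
    rw [← ZMod.intCast_zmod_eq_zero_iff_dvd]
    simp_all
  obtain ⟨n, hn⟩ := hmod
  refine ⟨n, ?_⟩
  rw [show (x : ℤ) + n * y = ((u : ZMod (y * b)).val : ℤ) by linarith]
  exact Nat.isCoprime_iff_coprime.2 (Nat.Coprime.coprime_mul_left_right (ZMod.val_coe_unit_coprime u))

/-- Some common factor `g` of `a` and `b` is, up to sign, the gcd of `b` and a suitable `s + n * a`. -/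
theorem exists_common_factor_isCoprime_add_mul {a b s : ℕ} (ha : a ≠ 0) (hb : b ≠ 0) :
    ∃ (g n t a' b' : ℤ), (a : ℤ) = g * a' ∧ (b : ℤ) = g * b' ∧ (s : ℤ) + n * a = g * t ∧
      IsCoprime t b' := by
  obtain ⟨x, y, hxy, hx, hy⟩ := Nat.exists_coprime s a
  obtain ⟨h, b', hhb, hh, hb'⟩ := Nat.exists_coprime (s.gcd a) b
  have hy0 : y ≠ 0 := by rintro rfl; exact ha (hy.trans (zero_mul _))
  have hb0 : b' ≠ 0 := by rintro rfl; exact hb (hb'.trans (zero_mul _))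
  obtain ⟨n, hn⟩ := exists_isCoprime_add_mul hy0 hb0 hxy
  set g := (s.gcd a).gcd b
  refine ⟨g, n, h * (x + n * y), y * h, b', ?_, ?_, ?_,
    IsCoprime.mul_left (Nat.isCoprime_iff_coprime.2 hhb) hn⟩
  · rw [hh] at hy
    rw [hy]; push_cast; ring
  · rw [hb']; push_cast; ring
  · rw [hh] at hx hy
    rw [hx, hy]; push_cast; ring

/-- Shear decomposition (Theorem 3 of the paper). Every lattice
generator `A = [[a, 0], [s, b]]` in normal form can be written as
`A = U_{s₀,s₁} · D · V` with `U_{s₀,s₁} = [[1, −s₀], [−s₁, s₀·s₁ + 1]]`, `D` diagonal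
and `det V = 1`; i.e. every lattice is the image of a separable lattice under at most
one time-side and one frequency-side shear. -/
theorem shear_decomposition (L : ℕ) [NeZero L] (a b s : ℕ)
    (ha : a ∣ L) (hb : b ∣ L) (hb0 : 0 < b) (hs : s < b)
    (hdvd : (a * b / Nat.gcd (a * b) L) ∣ s) :
    ∃ (s₀ s₁ : ℤ) (D V : Matrix (Fin 2) (Fin 2) (ZMod L)),
      D 0 1 = 0 ∧ D 1 0 = 0 ∧ V.det = 1 ∧
      !![(a : ZMod L), 0; (s : ZMod L), (b : ZMod L)] =
        !![((1 : ℤ) : ZMod L), ((-s₀ : ℤ) : ZMod L);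
           ((-s₁ : ℤ) : ZMod L), ((s₀ * s₁ + 1 : ℤ) : ZMod L)] * D * V := by
  have ha0 : a ≠ 0 := ne_zero_of_dvd_ne_zero (NeZero.ne L) ha
  obtain ⟨g, n, t, a', b', hag, hbg, hsg, p, q, hpq⟩ :=
    exists_common_factor_isCoprime_add_mul (s := s) ha0 hb0.ne'
  have hag' := congrArg (Int.cast : ℤ → ZMod L) hag
  have hbg' := congrArg (Int.cast : ℤ → ZMod L) hbg
  have hsg' := congrArg (Int.cast : ℤ → ZMod L) hsg
  have hpq' := congrArg (Int.cast : ℤ → ZMod L) hpq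
  push_cast at hag' hbg' hsg' hpq'
  refine ⟨-(a' * p), n, !![(g * a' * b' : ZMod L), 0; 0, (g : ZMod L)],
    !![(q : ZMod L), -(p : ZMod L); (t : ZMod L), (b' : ZMod L)], by simp, by simp, ?_, ?_⟩
  · rw [Matrix.det_fin_two_of]
    linear_combination hpq'
  · ext i j
    fin_cases i <;> fin_cases j <;> simp [Matrix.mul_apply, Fin.sum_univ_two]
    · linear_combination hag' - g * a' * hpq'
    · ring
    · linear_combination hsg' - n * hag' + n * g * a' * hpq'
    · linear_combination hbg'
end

section
/- Let a, M, λ₁, λ₂ be positive natural numbers with gcd(λ₁, λ₂) = 1, and set c = gcd(a, M). Let c₁ be a divisor of c such that gcd(c₁, λ₂) = 1 and every prime dividing c/c₁ also divides λ₂ (c₁ is the largest divisor of c coprime to λ₂). Then for every positive natural number n, setting L = n·λ₂·lcm(a, M)·(c/c₁), b = L/M, and s = λ₁·b/λ₂, there exists a natural number k with k < M such that a ∣ s + k·b; i.e. for all signal lengths of the form L = n·L_min·c/c₁ the frequency-side shear can be chosen to be zero. -/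
/-- An arithmetic progression whose step is coprime to `m` reaches a multiple of `m` within its
first `m` terms. -/
theorem exists_lt_dvd_add_mul_of_coprime {m q : ℕ} (hm : 0 < m) (h : Nat.Coprime q m) (r : ℕ) :
    ∃ k < m, m ∣ r + k * q := by
  have : NeZero m := ⟨hm.ne'⟩
  refine ⟨(-(r : ZMod m) * (q : ZMod m)⁻¹).val, ZMod.val_lt _, ?_⟩
  rw [← ZMod.natCast_eq_zero_iff]
  push_cast
  rw [ZMod.natCast_zmod_val, mul_assoc, mul_comm _ (q : ZMod m), ZMod.coe_mul_inv_eq_one q h]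
  ring

/-- No frequency-side shear needed. Let `c = gcd(a, M)` and let `c₁` be
the largest divisor of `c` coprime to `λ₂` (i.e. `c₁ ∣ c`, `gcd(c₁, λ₂) = 1` and every
prime dividing `c/c₁` divides `λ₂`). Then for every `n > 0`, with
`L = n·λ₂·lcm(a, M)·(c/c₁)`, `b = L/M` and `s = λ₁·b/λ₂`, there exists `k < M` with
`a ∣ s + k·b`; i.e. the frequency-side shear can be chosen to be zero. -/
theorem no_frequency_shear_lengths (a M lam1 lam2 : ℕ)
    (ha : 0 < a) (hM : 0 < M) (h1 : 0 < lam1) (h2 : 0 < lam2)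
    (hco : Nat.gcd lam1 lam2 = 1) (c₁ : ℕ) (hc₁ : c₁ ∣ Nat.gcd a M)
    (hc₁co : Nat.gcd c₁ lam2 = 1)
    (hmax : ∀ p : ℕ, p.Prime → p ∣ Nat.gcd a M / c₁ → p ∣ lam2)
    (n : ℕ) (hn : 0 < n) :
    ∃ k : ℕ, k < M ∧
      a ∣ lam1 * (n * lam2 * Nat.lcm a M * (Nat.gcd a M / c₁) / M) / lam2 +
        k * (n * lam2 * Nat.lcm a M * (Nat.gcd a M / c₁) / M) := by
  have hc : 0 < Nat.gcd a M := Nat.gcd_pos_of_pos_left M ha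
  obtain ⟨k, hk, hdvd⟩ := exists_lt_dvd_add_mul_of_coprime
    (Nat.pos_of_dvd_of_pos hc₁ hc) (Nat.Coprime.symm hc₁co) lam1
  refine ⟨k, hk.trans_le (Nat.le_of_dvd hM (hc₁.trans (Nat.gcd_dvd_right a M))), ?_⟩
  obtain ⟨a', ha'⟩ := Nat.gcd_dvd_left a M
  have hlcm : Nat.lcm a M = a' * M := by
    apply Nat.eq_of_mul_eq_mul_left hc
    rw [Nat.gcd_mul_lcm, ← mul_assoc, ← ha']
  have hd : c₁ * (Nat.gcd a M / c₁) = Nat.gcd a M := Nat.mul_div_cancel' hc₁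
  generalize Nat.gcd a M / c₁ = d at hd ⊢
  have hb : n * lam2 * Nat.lcm a M * d / M = n * lam2 * a' * d := by
    rw [hlcm, show n * lam2 * (a' * M) * d = n * lam2 * a' * d * M by ring,
      Nat.mul_div_cancel _ hM]
  have hs : lam1 * (n * lam2 * a' * d) / lam2 = lam1 * (n * a' * d) := by
    rw [show lam1 * (n * lam2 * a' * d) = lam1 * (n * a' * d) * lam2 by ring,
      Nat.mul_div_cancel _ h2]
  rw [hb, hs, show lam1 * (n * a' * d) + k * (n * lam2 * a' * d) =
    n * a' * d * (lam1 + k * lam2) by ring]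
  have ha_eq : a = a' * d * c₁ := by
    rw [mul_assoc, mul_comm d, hd, mul_comm]
    exact ha'
  calc a = a' * d * c₁ := ha_eq
    _ ∣ a' * d * (lam1 + k * lam2) := mul_dvd_mul_left _ hdvd
    _ ∣ n * a' * d * (lam1 + k * lam2) := ⟨n, by ring⟩
end
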